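/- arXiv:2510.03373 — 2 statements merged into one kernel-verified Lean document; each statement's English description precedes it below -/
import Mathlib

section
/- For every real number k with 1 < k < ∞, the set of numbers whose modified Engel digits have all consecutive ratios at most k has full Hausdorff dimension; that is, dim_H { E'(c) : c = (c_n)_{n≥1} a strictly increasing sequence of integers with c₁ ≥ 2 and c_{n+1} ≤ k·c_n for all n ≥ 1 } = 1. -/
open Filter

noncomputable section

/-- The classical Engel series `E(c) = ∑_{n≥1} 1/(c₁c₂⋯c_n)` (0-based: `c 0 = c₁`). -/
def engel (c : ℕ → ℕ) : ℝ :=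
  ∑' n : ℕ, 1 / ∏ i ∈ Finset.range (n + 1), (c i : ℝ)

/-- The modified Engel series
`E'(c) = 1/c₁ + ∑_{n≥1} 1/((c₁−1)(c₂−1)⋯(c_n−1)·c_{n+1})` (0-based: `c 0 = c₁`). -/
def modEngel (c : ℕ → ℕ) : ℝ :=
  1 / (c 0 : ℝ) +
    ∑' n : ℕ, 1 / ((∏ i ∈ Finset.range (n + 1), ((c i : ℝ) - 1)) * (c (n + 1) : ℝ))

/-- The digit shift `σ(c)_n = c_n + n − 1` (0-based: `σ(c) (n-1) = c (n-1) + (n-1)`). -/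
def engelShift (c : ℕ → ℕ) : ℕ → ℕ := fun n => c n + n

/-- The Pierce series in Perron notation
`Π(c) = ∑_{n≥0} (−1)^n/((c₁−1)⋯(c_n−1)(c_{n+1}−1))` (0-based: `c 0 = c₁`). -/
def pierce (c : ℕ → ℕ) : ℝ :=
  ∑' n : ℕ, (-1 : ℝ) ^ n / ((∏ i ∈ Finset.range n, ((c i : ℝ) - 1)) * ((c n : ℝ) - 1))

/-- The traditional Pierce series `Π̃(d) = ∑_{n≥1} (−1)^{n+1}/(d₁d₂⋯d_n)` (0-based: `d 0 = d₁`). -/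
def pierceTrad (d : ℕ → ℕ) : ℝ :=
  ∑' n : ℕ, (-1 : ℝ) ^ n / ∏ i ∈ Finset.range (n + 1), (d i : ℝ)

end

noncomputable section

/-! ### The growth sequence -/

lemma exists_growth (k : ℝ) (hk : 1 < k) (r : ℝ) (hr0 : 0 < r) (hr1 : r < 1) :
    ∃ A : ℕ → ℕ, 2 ≤ A 0 ∧ (∀ n, A n + 2 ≤ A (n + 1)) ∧
      (∀ n, (A (n + 2) : ℝ) ≤ k * A n) ∧
      (∀ n, (A (n + 3) : ℝ) ^ r ≤ ((A (n + 1) - A n : ℕ) : ℝ)) := by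
  obtain ⟨q, hq⟩ := exists_nat_gt (1 / (1 - r))
  have h1r : 0 < 1 - r := by linarith
  have hq1 : 1 < (q : ℝ) * (1 - r) := by rwa [div_lt_iff₀ h1r] at hq
  have hq2 : ((q + 1 : ℕ) : ℝ) * r < q := by push_cast; nlinarith
  have hq0 : 1 ≤ q := by
    rcases Nat.eq_zero_or_pos q with h | h
    · subst h; norm_num at hq1
    · exact h
  have e1 : ∀ᶠ j : ℕ in atTop, ((j : ℝ) + 2) ^ (q + 1) ≤ k * (j : ℝ) ^ (q + 1) := by
    have t : Tendsto (fun j : ℕ => (1 + 2 / (j : ℝ)) ^ (q + 1)) atTop (nhds 1) := by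
      have := ((tendsto_const_div_atTop_nhds_zero_nat (2 : ℝ)).const_add 1).pow (q + 1)
      simpa using this
    filter_upwards [t.eventually_lt_const hk, eventually_ge_atTop 1] with j hj hj1
    have hj0 : (0 : ℝ) < j := by exact_mod_cast hj1
    have : ((j : ℝ) + 2) = (1 + 2 / (j : ℝ)) * j := by field_simp
    rw [this, mul_pow]
    gcongr
  have e2 : ∀ᶠ j : ℕ in atTop,
      (((j : ℝ) + 3) ^ (q + 1)) ^ r ≤ (j : ℝ) ^ q := by
    have t : Tendsto (fun j : ℕ => (j : ℝ) ^ ((q : ℝ) - ((q + 1 : ℕ) : ℝ) * r)) atTop atTop :=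
      (tendsto_rpow_atTop (by linarith)).comp tendsto_natCast_atTop_atTop
    filter_upwards [t.eventually_ge_atTop ((4 : ℝ) ^ (((q + 1 : ℕ) : ℝ) * r)),
      eventually_ge_atTop 1] with j hj hj1
    have hj0 : (0 : ℝ) < j := by exact_mod_cast hj1
    have hj1' : (1 : ℝ) ≤ j := by exact_mod_cast hj1
    rw [← Real.rpow_natCast, ← Real.rpow_mul (by positivity)]
    calc ((j : ℝ) + 3) ^ (((q + 1 : ℕ) : ℝ) * r)
        ≤ (4 * (j : ℝ)) ^ (((q + 1 : ℕ) : ℝ) * r) := by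
          apply Real.rpow_le_rpow (by positivity) (by linarith) (by positivity)
      _ = 4 ^ (((q + 1 : ℕ) : ℝ) * r) * (j : ℝ) ^ (((q + 1 : ℕ) : ℝ) * r) := by
          rw [Real.mul_rpow (by norm_num) hj0.le]
      _ ≤ (j : ℝ) ^ ((q : ℝ) - ((q + 1 : ℕ) : ℝ) * r) * (j : ℝ) ^ (((q + 1 : ℕ) : ℝ) * r) := by
          gcongr
      _ = (j : ℝ) ^ q := by
          rw [← Real.rpow_add hj0, sub_add_cancel, Real.rpow_natCast]
  obtain ⟨N, hN⟩ := eventually_atTop.1 (e1.and (e2.and (eventually_ge_atTop 2)))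
  have hN2 : 2 ≤ N := (hN N le_rfl).2.2
  have key : ∀ j : ℕ, j ^ (q + 1) + j ^ q ≤ (j + 1) ^ (q + 1) := by
    intro j
    calc j ^ (q + 1) + j ^ q = j ^ q * (j + 1) := by ring
      _ ≤ (j + 1) ^ q * (j + 1) := by gcongr; omega
      _ = _ := by ring
  refine ⟨fun n => (N + n) ^ (q + 1), ?_, ?_, ?_, ?_⟩
  · calc 2 ≤ N := hN2
      _ = N ^ 1 := by simp
      _ ≤ N ^ (q + 1) := Nat.pow_le_pow_right (by omega) (by omega)
      _ = (N + 0) ^ (q + 1) := by simp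
  · intro n
    have h := key (N + n)
    have h2 : 2 ≤ (N + n) ^ q := by
      calc 2 ≤ (N + n) ^ 1 := by simp; omega
        _ ≤ (N + n) ^ q := Nat.pow_le_pow_right (by omega) (by omega)
    show (N + n) ^ (q + 1) + 2 ≤ (N + n + 1) ^ (q + 1)
    omega
  · intro n
    have h := (hN (N + n) (by omega)).1
    push_cast at h ⊢
    rw [← add_assoc]
    exact h
  · intro n
    have h := (hN (N + n) (by omega)).2.1
    have h3 : (N + n) ^ q ≤ (N + (n + 1)) ^ (q + 1) - (N + n) ^ (q + 1) := by
      have := key (N + n)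
      rw [← add_assoc]
      omega
    have h4 : (((N + n) ^ q : ℕ) : ℝ) ≤
      (((N + (n + 1)) ^ (q + 1) - (N + n) ^ (q + 1) : ℕ) : ℝ) := by exact_mod_cast h3
    refine le_trans ?_ h4
    push_cast at h ⊢
    rw [← add_assoc]
    exact h

/-! ### The modified Engel series -/

/-- Product of the digits minus one. -/
def engP (c : ℕ → ℕ) (n : ℕ) : ℝ := ∏ i ∈ Finset.range n, ((c i : ℝ) - 1)

/-- General term of the modified Engel series. -/
def engT (c : ℕ → ℕ) (n : ℕ) : ℝ := 1 / (engP c n * (c n : ℝ))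

lemma eng_ge_two {c : ℕ → ℕ} (hc : StrictMono c) (h0 : 2 ≤ c 0) (n : ℕ) : (2 : ℝ) ≤ c n := by
  have : c 0 ≤ c n := hc.monotone (Nat.zero_le n)
  exact_mod_cast h0.trans this

lemma engP_pos {c : ℕ → ℕ} (hc : StrictMono c) (h0 : 2 ≤ c 0) (n : ℕ) : 0 < engP c n :=
  Finset.prod_pos fun i _ => by have := eng_ge_two hc h0 i; linarith

lemma engP_succ (c : ℕ → ℕ) (n : ℕ) : engP c (n + 1) = engP c n * ((c n : ℝ) - 1) :=
  Finset.prod_range_succ _ _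

lemma engT_nonneg {c : ℕ → ℕ} (hc : StrictMono c) (h0 : 2 ≤ c 0) (n : ℕ) : 0 ≤ engT c n := by
  have := engP_pos hc h0 n
  unfold engT; positivity

lemma eng_step {c : ℕ → ℕ} (hc : StrictMono c) (h0 : 2 ≤ c 0) (n : ℕ) :
    engT c n + 1 / engP c (n + 2) ≤ 1 / engP c (n + 1) := by
  have hP := engP_pos hc h0 n
  have h2 := eng_ge_two hc h0 n
  have h3 : (c n : ℝ) + 1 ≤ c (n + 1) := by exact_mod_cast hc (Nat.lt_succ_self n)
  rw [engP_succ c (n + 1), engP_succ c n, engT]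
  have e : 1 / (engP c n * ((c n : ℝ) - 1)) - 1 / (engP c n * (c n : ℝ))
      = 1 / (engP c n * ((c n : ℝ) - 1) * c n) := by
    have : (c n : ℝ) - 1 ≠ 0 := by linarith
    have : (c n : ℝ) ≠ 0 := by linarith
    field_simp
    ring
  have : 1 / (engP c n * ((c n : ℝ) - 1) * ((c (n + 1) : ℝ) - 1)) ≤
      1 / (engP c n * ((c n : ℝ) - 1) * c n) := by
    have h1 : 0 < (c n : ℝ) - 1 := by linarith
    apply one_div_le_one_div_of_le (by positivity)
    apply mul_le_mul_of_nonneg_left (by linarith) (by positivity)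
  linarith

lemma eng_partial {c : ℕ → ℕ} (hc : StrictMono c) (h0 : 2 ≤ c 0) (n m : ℕ) :
    ∑ i ∈ Finset.range (n + m), engT c i + 1 / engP c (n + m + 1)
      ≤ ∑ i ∈ Finset.range n, engT c i + 1 / engP c (n + 1) := by
  induction m with
  | zero => simp
  | succ m ih =>
    refine le_trans ?_ ih
    rw [← add_assoc, Finset.sum_range_succ]
    have := eng_step hc h0 (n + m)
    linarith

lemma eng_partial_le {c : ℕ → ℕ} (hc : StrictMono c) (h0 : 2 ≤ c 0) (n N : ℕ) :
    ∑ i ∈ Finset.range N, engT c i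
      ≤ ∑ i ∈ Finset.range n, engT c i + 1 / engP c (n + 1) := by
  have h1 : ∑ i ∈ Finset.range N, engT c i ≤ ∑ i ∈ Finset.range (n + N), engT c i :=
    Finset.sum_le_sum_of_subset_of_nonneg (Finset.range_mono (by omega))
      fun i _ _ => engT_nonneg hc h0 i
  have h2 := eng_partial hc h0 n N
  have h3 : 0 ≤ 1 / engP c (n + N + 1) := by
    have := engP_pos hc h0 (n + N + 1); positivity
  linarith

lemma eng_summable {c : ℕ → ℕ} (hc : StrictMono c) (h0 : 2 ≤ c 0) : Summable (engT c) :=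
  summable_of_sum_range_le (engT_nonneg hc h0) (eng_partial_le hc h0 0)

lemma modEngel_eq {c : ℕ → ℕ} (hc : StrictMono c) (h0 : 2 ≤ c 0) :
    modEngel c = ∑' n, engT c n := by
  rw [(eng_summable hc h0).tsum_eq_zero_add]
  simp [modEngel, engT, engP]

lemma modEngel_le {c : ℕ → ℕ} (hc : StrictMono c) (h0 : 2 ≤ c 0) (n : ℕ) :
    modEngel c ≤ ∑ i ∈ Finset.range n, engT c i + 1 / engP c (n + 1) := by
  rw [modEngel_eq hc h0]
  exact Real.tsum_le_of_sum_range_le (engT_nonneg hc h0) (eng_partial_le hc h0 n)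

lemma le_modEngel {c : ℕ → ℕ} (hc : StrictMono c) (h0 : 2 ≤ c 0) (n : ℕ) :
    ∑ i ∈ Finset.range n, engT c i ≤ modEngel c := by
  rw [modEngel_eq hc h0]
  exact (eng_summable hc h0).sum_le_tsum _ fun i _ => engT_nonneg hc h0 i

lemma modEngel_gap {c c' : ℕ → ℕ} (hc : StrictMono c) (h0 : 2 ≤ c 0)
    (hc' : StrictMono c') (h0' : 2 ≤ c' 0) (n : ℕ) (hag : ∀ i < n, c i = c' i)
    (hlt : c n < c' n) :
    1 / ∏ i ∈ Finset.range (n + 2), (c i : ℝ) ≤ modEngel c - modEngel c' := by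
  have h1 := le_modEngel hc h0 (n + 2)
  have h2 := modEngel_le hc' h0' n
  have hP : ∀ j ≤ n, engP c j = engP c' j := fun j hj =>
    Finset.prod_congr rfl fun i hi => by
      rw [hag i ((Finset.mem_range.1 hi).trans_le hj)]
  have hS : ∑ i ∈ Finset.range n, engT c i = ∑ i ∈ Finset.range n, engT c' i :=
    Finset.sum_congr rfl fun i hi => by
      have hi := Finset.mem_range.1 hi
      rw [engT, engT, hP i hi.le, hag i hi]
  rw [Finset.sum_range_succ, Finset.sum_range_succ] at h1
  have hPn := engP_pos hc h0 n
  have hg := eng_ge_two hc h0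
  have h3 : 1 / engP c' (n + 1) ≤ engT c n := by
    rw [engT, engP_succ, ← hP n le_rfl]
    have hl : (c n : ℝ) + 1 ≤ c' n := by exact_mod_cast hlt
    have := hg n
    apply one_div_le_one_div_of_le (by positivity)
    apply mul_le_mul_of_nonneg_left (by linarith) hPn.le
  have h4 : 1 / ∏ i ∈ Finset.range (n + 2), (c i : ℝ) ≤ engT c (n + 1) := by
    rw [engT, Finset.prod_range_succ]
    have hp := engP_pos hc h0 (n + 1)
    have := hg (n + 1)
    apply one_div_le_one_div_of_le (by positivity)
    apply mul_le_mul_of_nonneg_right _ (by linarith)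
    exact Finset.prod_le_prod (fun i _ => by have := hg i; linarith) fun i _ => by linarith
  linarith

/-! ### Mixed radix expansions -/

/-- Remainders of the mixed radix expansion of `t` with bases `m`. -/
def mrRest (m : ℕ → ℕ) (t : ℝ) : ℕ → ℝ
  | 0 => t
  | n + 1 => m n * mrRest m t n - (⌊(m n : ℝ) * mrRest m t n⌋₊ : ℝ)

/-- Digits of the mixed radix expansion of `t` with bases `m`. -/
def mrDigit (m : ℕ → ℕ) (t : ℝ) (n : ℕ) : ℕ := ⌊(m n : ℝ) * mrRest m t n⌋₊

lemma mrRest_mem (m : ℕ → ℕ) {t : ℝ} (ht : t ∈ Set.Ico (0 : ℝ) 1) (n : ℕ) :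
    mrRest m t n ∈ Set.Ico (0 : ℝ) 1 := by
  induction n with
  | zero => exact ht
  | succ n ih =>
    have h0 : 0 ≤ (m n : ℝ) * mrRest m t n := mul_nonneg (by positivity) ih.1
    have h1 := Nat.floor_le h0
    have h2 := Nat.lt_floor_add_one ((m n : ℝ) * mrRest m t n)
    constructor <;> simp only [mrRest] <;> linarith

lemma mrDigit_lt (m : ℕ → ℕ) (hm : ∀ n, 0 < m n) {t : ℝ} (ht : t ∈ Set.Ico (0 : ℝ) 1) (n : ℕ) :
    mrDigit m t n < m n := by
  have h := mrRest_mem m ht n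
  have hm' : (0 : ℝ) < m n := by exact_mod_cast hm n
  rw [mrDigit, Nat.floor_lt (mul_nonneg hm'.le h.1)]
  nlinarith [h.2]

lemma mr_diff (m : ℕ → ℕ) {t t' : ℝ} (n : ℕ)
    (hag : ∀ i < n, mrDigit m t i = mrDigit m t' i) :
    (∏ i ∈ Finset.range n, (m i : ℝ)) * (t - t') = mrRest m t n - mrRest m t' n := by
  induction n with
  | zero => simp [mrRest]
  | succ n ih =>
    have e := hag n (Nat.lt_succ_self n)
    have ih := ih fun i hi => hag i (hi.trans (Nat.lt_succ_self n))
    unfold mrDigit at e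
    rw [Finset.prod_range_succ, mul_right_comm, ih]
    simp only [mrRest]
    rw [e]
    ring

lemma mr_close (m : ℕ → ℕ) (hm : ∀ n, 0 < m n) {t t' : ℝ} (ht : t ∈ Set.Ico (0 : ℝ) 1)
    (ht' : t' ∈ Set.Ico (0 : ℝ) 1) (n : ℕ)
    (hag : ∀ i < n, mrDigit m t i = mrDigit m t' i) :
    |t - t'| ≤ 1 / ∏ i ∈ Finset.range n, (m i : ℝ) := by
  have hp : 0 < ∏ i ∈ Finset.range n, (m i : ℝ) :=
    Finset.prod_pos fun i _ => by exact_mod_cast hm i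
  rw [le_div_iff₀ hp, mul_comm]
  have h := mr_diff m n hag
  have a := mrRest_mem m ht n
  have b := mrRest_mem m ht' n
  calc _ = |(∏ i ∈ Finset.range n, (m i : ℝ)) * (t - t')| := by rw [abs_mul, abs_of_pos hp]
    _ ≤ 1 := by
      rw [h, abs_le]; constructor <;> linarith [a.1, a.2, b.1, b.2]

lemma mr_inj (m : ℕ → ℕ) (hm : ∀ n, 2 ≤ m n) {t t' : ℝ} (ht : t ∈ Set.Ico (0 : ℝ) 1)
    (ht' : t' ∈ Set.Ico (0 : ℝ) 1) (hag : ∀ i, mrDigit m t i = mrDigit m t' i) : t = t' := by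
  by_contra hne
  have hpos : 0 < |t - t'| := abs_pos.2 (sub_ne_zero.2 hne)
  obtain ⟨n, hn⟩ := exists_pow_lt_of_lt_one hpos (show (1 / 2 : ℝ) < 1 by norm_num)
  have h := mr_close m (fun n => by have := hm n; omega) ht ht' n fun i _ => hag i
  have h2 : (2 : ℝ) ^ n ≤ ∏ i ∈ Finset.range n, (m i : ℝ) := by
    calc (2 : ℝ) ^ n = ∏ i ∈ Finset.range n, (2 : ℝ) := by simp
      _ ≤ _ := Finset.prod_le_prod (fun _ _ => by norm_num) fun i _ => by exact_mod_cast hm i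
  have h3 := one_div_le_one_div_of_le (by positivity) h2
  rw [one_div_pow] at hn
  linarith

/-! ### The Hölder estimate -/

lemma holder_est (A : ℕ → ℕ) (r : ℝ) (hr0 : 0 < r) (hA0 : 2 ≤ A 0)
    (hA : ∀ n, A n + 2 ≤ A (n + 1))
    (hAr : ∀ n, (A (n + 3) : ℝ) ^ r ≤ ((A (n + 1) - A n : ℕ) : ℝ))
    (x : ℝ → ℝ) (hx : ∀ t, x t = modEngel fun n => A n + mrDigit (fun n => A (n + 1) - A n) t n)
    (hc : ∀ t ∈ Set.Ico (0 : ℝ) 1,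
      StrictMono fun n => A n + mrDigit (fun n => A (n + 1) - A n) t n)
    (t t' : ℝ) (ht : t ∈ Set.Ico (0 : ℝ) 1) (ht' : t' ∈ Set.Ico (0 : ℝ) 1) :
    |t - t'| ≤ ((A 1 : ℝ) * A 2) ^ r * |x t - x t'| ^ r := by
  set m : ℕ → ℕ := fun n => A (n + 1) - A n with hm
  have hm2 : ∀ n, 2 ≤ m n := fun n => by have := hA n; simp only [hm]; omega
  have hApos : ∀ n, 0 < A n := fun n => by
    cases n with
    | zero => omega
    | succ n => have := hA n; omega
  have hAposR : ∀ n, (0 : ℝ) < A n := fun n => by exact_mod_cast hApos n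
  have hMpos : ∀ n, 0 < ∏ i ∈ Finset.range n, (m i : ℝ) := fun n =>
    Finset.prod_pos fun i _ => by have := hm2 i; exact_mod_cast (by omega : 0 < m i)
  have hQpos : ∀ n, 0 < ∏ i ∈ Finset.range n, (A (i + 1) : ℝ) := fun n =>
    Finset.prod_pos fun i _ => hAposR _
  have hQ : ∀ n, (∏ i ∈ Finset.range (n + 2), (A (i + 1) : ℝ)) ^ r
      ≤ ((A 1 : ℝ) * A 2) ^ r * ∏ i ∈ Finset.range n, (m i : ℝ) := by
    intro n
    induction n with
    | zero => simp [Finset.prod_range_succ]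
    | succ n ih =>
      rw [Finset.prod_range_succ, Finset.prod_range_succ _ n,
        Real.mul_rpow (hQpos _).le (hAposR _).le, ← mul_assoc]
      exact mul_le_mul ih (hAr n) (Real.rpow_nonneg (hAposR _).le _)
        (mul_nonneg (Real.rpow_nonneg (by positivity) _) (hMpos n).le)
  -- main case, then symmetry
  have main : ∀ t t' : ℝ, t ∈ Set.Ico (0 : ℝ) 1 → t' ∈ Set.Ico (0 : ℝ) 1 → ∀ n,
      (∀ i < n, mrDigit m t i = mrDigit m t' i) → mrDigit m t n < mrDigit m t' n →
      |t - t'| ≤ ((A 1 : ℝ) * A 2) ^ r * |x t - x t'| ^ r := by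
    intro t t' ht ht' n hag hlt
    have g := modEngel_gap (hc t ht) (hA0.trans (Nat.le_add_right _ _)) (hc t' ht')
      (hA0.trans (Nat.le_add_right _ _)) n
      (fun i hi => by simp only [hag i hi]) (by simpa using hlt)
    rw [← hx, ← hx] at g
    have g2 : 1 / ∏ i ∈ Finset.range (n + 2), (A (i + 1) : ℝ) ≤ |x t - x t'| := by
      refine le_trans ?_ (g.trans (le_abs_self _))
      apply one_div_le_one_div_of_le
      · exact Finset.prod_pos fun i _ => by
          have := hApos i
          exact_mod_cast (by omega : 0 < A i + mrDigit m t i)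
      · apply Finset.prod_le_prod (fun _ _ => by positivity)
        intro i _
        have h1 := mrDigit_lt m (fun n => by have := hm2 n; omega) ht i
        have h2 := hA i
        have h3 : A i + mrDigit m t i ≤ A (i + 1) := by
          simp only [hm] at h1 ⊢; omega
        exact_mod_cast h3
    have g3 := Real.rpow_le_rpow (one_div_pos.2 (hQpos _)).le g2 hr0.le
    have c1 := mr_close m (fun n => by have := hm2 n; omega) ht ht' n hag
    refine c1.trans ?_
    refine le_trans ?_ (mul_le_mul_of_nonneg_left g3 (Real.rpow_nonneg (by positivity) _))
    rw [Real.div_rpow zero_le_one (hQpos _).le, Real.one_rpow, mul_one_div,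
      div_le_div_iff₀ (hMpos n) (Real.rpow_pos_of_pos (hQpos _) _), one_mul]
    exact hQ n
  by_cases h : ∀ i, mrDigit m t i = mrDigit m t' i
  · have := mr_inj m hm2 ht ht' h
    subst this
    simp only [sub_self, abs_zero]
    positivity
  · push Not at h
    classical
    have hs := Nat.find_spec h
    have hmin : ∀ i < Nat.find h, mrDigit m t i = mrDigit m t' i := fun i hi => by
      have := Nat.find_min h hi
      push Not at this
      exact this
    rcases lt_or_gt_of_ne hs with hlt | hlt
    · exact main t t' ht ht' _ hmin hlt
    · rw [abs_sub_comm, abs_sub_comm (x t)]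
      exact main t' t ht' ht _ (fun i hi => (hmin i hi).symm) hlt

lemma le_dimH_of_expanding (x : ℝ → ℝ) (r K : NNReal) (hr : 0 < r) (S : Set ℝ)
    (hS : ∀ t ∈ Set.Ico (0 : ℝ) 1, x t ∈ S)
    (h : ∀ t ∈ Set.Ico (0 : ℝ) 1, ∀ t' ∈ Set.Ico (0 : ℝ) 1,
      |t - t'| ≤ K * |x t - x t'| ^ (r : ℝ)) : (r : ENNReal) ≤ dimH S := by
  set f := Function.invFunOn x (Set.Ico (0 : ℝ) 1) with hf
  have hinj : Set.InjOn x (Set.Ico (0 : ℝ) 1) := by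
    intro t ht t' ht' e
    have := h t ht t' ht'
    rw [e, sub_self, abs_zero, Real.zero_rpow (by exact_mod_cast hr.ne'), mul_zero] at this
    exact sub_eq_zero.1 (abs_nonpos_iff.1 this)
  have hfx : ∀ t ∈ Set.Ico (0 : ℝ) 1, f (x t) = t := fun t ht => hinj.leftInvOn_invFunOn ht
  have hH : HolderOnWith K r f (x '' Set.Ico (0 : ℝ) 1) := by
    rintro _ ⟨t, ht, rfl⟩ _ ⟨t', ht', rfl⟩
    rw [hfx t ht, hfx t' ht', edist_dist, edist_dist, Real.dist_eq, Real.dist_eq,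
      ENNReal.ofReal_rpow_of_nonneg (abs_nonneg _) r.coe_nonneg,
      ← ENNReal.ofReal_coe_nnreal, ← ENNReal.ofReal_mul K.coe_nonneg]
    exact ENNReal.ofReal_le_ofReal (h t ht t' ht')
  have himg : f '' (x '' Set.Ico (0 : ℝ) 1) = Set.Ico (0 : ℝ) 1 := by
    rw [Set.image_image]
    ext t
    constructor
    · rintro ⟨s, hs, rfl⟩
      simpa only [hfx s hs] using hs
    · exact fun ht => ⟨t, ht, hfx t ht⟩
  have hd := hH.dimH_image_le hr
  have h1 : dimH (Set.Ico (0 : ℝ) 1) = 1 := by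
    rw [Real.dimH_of_nonempty_interior]
    · simp
    · rw [interior_Ico]; exact Set.nonempty_Ioo.2 zero_lt_one
  rw [himg, h1, ENNReal.le_div_iff_mul_le (by left; exact_mod_cast hr.ne') (by left; simp),
    one_mul] at hd
  refine hd.trans (dimH_mono ?_)
  rintro _ ⟨t, ht, rfl⟩
  exact hS t ht

end

/-- For every `1 < k < ∞`, the set of numbers whose modified Engel digits
satisfy `c_{n+1} ≤ k·c_n` for all `n` has Hausdorff dimension `1`. -/
theorem dimH_modEngel_bounded_ratio (k : ℝ) (hk : 1 < k) :
    dimH {x : ℝ | ∃ c : ℕ → ℕ, StrictMono c ∧ 2 ≤ c 0 ∧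
        (∀ n : ℕ, (c (n + 1) : ℝ) ≤ k * (c n : ℝ)) ∧ x = modEngel c} = 1 := by
  apply le_antisymm
  · exact (dimH_mono (Set.subset_univ _)).trans_eq Real.dimH_univ
  refine ENNReal.le_of_forall_nnreal_lt fun r hr => ?_
  rcases eq_or_lt_of_le (show (0 : NNReal) ≤ r from bot_le) with h0 | h0
  · rw [← h0]; simp
  have hr1 : (r : ℝ) < 1 := by exact_mod_cast hr
  obtain ⟨A, hA0, hA, hAk, hAr⟩ := exists_growth k hk r (by exact_mod_cast h0) hr1
  have hlt : ∀ t ∈ Set.Ico (0 : ℝ) 1, ∀ n,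
      A n + mrDigit (fun n => A (n + 1) - A n) t n < A (n + 1) := by
    intro t ht n
    have h1 := mrDigit_lt (fun n => A (n + 1) - A n) (fun n => by have := hA n; omega) ht n
    have h2 := hA n
    omega
  have hc : ∀ t ∈ Set.Ico (0 : ℝ) 1,
      StrictMono fun n => A n + mrDigit (fun n => A (n + 1) - A n) t n := fun t ht =>
    strictMono_nat_of_lt_succ fun n => (hlt t ht n).trans_le (Nat.le_add_right _ _)
  refine le_dimH_of_expanding
    (fun t => modEngel fun n => A n + mrDigit (fun n => A (n + 1) - A n) t n) r
    (((A 1 : NNReal) * A 2) ^ (r : ℝ)) h0 _ ?_ ?_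
  · intro t ht
    refine ⟨_, hc t ht, hA0.trans (Nat.le_add_right _ _), fun n => ?_, rfl⟩
    have h1 := (hlt t ht (n + 1)).le
    have h1' : ((A (n + 1) + mrDigit (fun n => A (n + 1) - A n) t (n + 1) : ℕ) : ℝ)
      ≤ A (n + 2) := by exact_mod_cast h1
    refine h1'.trans ((hAk n).trans ?_)
    have : (A n : ℝ) ≤ ((A n + mrDigit (fun n => A (n + 1) - A n) t n : ℕ) : ℝ) := by
      exact_mod_cast Nat.le_add_right _ _
    exact mul_le_mul_of_nonneg_left this (by linarith)
  · intro t ht t' ht'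
    have := holder_est A r (by exact_mod_cast h0) hA0 hA hAr _ (fun _ => rfl) hc t t' ht ht'
    simpa using this
end

section
/- For every real number k ≥ 1, the set of numbers whose Pierce digits in Perron notation grow at least like e^{kn} for all n has full Hausdorff dimension; that is, dim_H { Π(c) : c = (c_n)_{n≥1} a strictly increasing sequence of integers with c_n ≥ e^{kn} for all n ≥ 1 } = 1. -/
open Filter

noncomputable section

namespace PierceAux

def TT (e : ℕ → ℝ) : ℝ := ∑' n : ℕ, (-1 : ℝ) ^ n / ∏ i ∈ Finset.range (n + 1), e i

lemma pierce_eq (c : ℕ → ℕ) : pierce c = TT (fun i => (c i : ℝ) - 1) := by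
  unfold pierce TT
  congr 1
  funext n
  rw [Finset.prod_range_succ]

lemma prod_ge (e : ℕ → ℝ) (h : ∀ i, 4 ≤ e i) (n : ℕ) :
    (4 : ℝ) ^ n ≤ ∏ i ∈ Finset.range n, e i := by
  have := Finset.prod_le_prod (s := Finset.range n) (f := fun _ => (4 : ℝ)) (g := e)
    (fun i _ => by norm_num) (fun i _ => h i)
  simpa using this

lemma term_bound (e : ℕ → ℝ) (h : ∀ i, 4 ≤ e i) (n : ℕ) :
    ‖(-1 : ℝ) ^ n / ∏ i ∈ Finset.range (n + 1), e i‖ ≤ (1 / 4) * (1 / 4 : ℝ) ^ n := by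
  have h1 := prod_ge e h (n + 1)
  have h2 : (0 : ℝ) < 4 ^ (n + 1) := by positivity
  rw [norm_div, norm_pow, norm_neg, norm_one, one_pow, Real.norm_of_nonneg (by linarith)]
  calc 1 / ∏ i ∈ Finset.range (n + 1), e i ≤ 1 / 4 ^ (n + 1) :=
        one_div_le_one_div_of_le h2 h1
    _ = _ := by rw [pow_succ, one_div_pow]; field_simp

lemma hasSum_geo : HasSum (fun n : ℕ => (1 / 4) * (1 / 4 : ℝ) ^ n) (1 / 3) := by
  have := (hasSum_geometric_of_lt_one (r := (1 / 4 : ℝ)) (by norm_num) (by norm_num)).mul_left (1 / 4)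
  have h : (1 / 4 : ℝ) * (1 - 1 / 4)⁻¹ = 1 / 3 := by norm_num
  rwa [h] at this

lemma summable_TT (e : ℕ → ℝ) (h : ∀ i, 4 ≤ e i) :
    Summable (fun n : ℕ => (-1 : ℝ) ^ n / ∏ i ∈ Finset.range (n + 1), e i) :=
  Summable.of_norm_bounded hasSum_geo.summable (term_bound e h)

lemma abs_TT_le (e : ℕ → ℝ) (h : ∀ i, 4 ≤ e i) : |TT e| ≤ 1 / 3 :=
  tsum_of_norm_bounded hasSum_geo (term_bound e h)

lemma TT_rec (e : ℕ → ℝ) (h : ∀ i, 4 ≤ e i) :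
    TT e = (1 - TT (fun i => e (i + 1))) / e 0 := by
  have h0 : e 0 ≠ 0 := by linarith [h 0]
  have : TT e = 1 / e 0 + ∑' n : ℕ, (-1 / e 0) * ((-1 : ℝ) ^ n / ∏ i ∈ Finset.range (n + 1), e (i + 1)) := by
    unfold TT
    rw [(summable_TT e h).tsum_eq_zero_add]
    congr 1
    · simp
    · congr 1
      funext n
      rw [Finset.prod_range_succ' _ (n + 1), pow_succ]
      have : ∏ i ∈ Finset.range (n + 1), e (i + 1) ≠ 0 := by
        have := prod_ge (fun i => e (i + 1)) (fun i => h _) (n + 1)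
        have h2 : (0 : ℝ) < 4 ^ (n + 1) := by positivity
        linarith
      field_simp
  rw [this, tsum_mul_left]
  change 1 / e 0 + -1 / e 0 * TT (fun i => e (i + 1)) = _
  field_simp
  ring

lemma TT_nonneg (e : ℕ → ℝ) (h : ∀ i, 4 ≤ e i) : 0 ≤ TT e := by
  rw [TT_rec e h]
  have := abs_le.1 (abs_TT_le (fun i => e (i + 1)) (fun i => h _))
  have := h 0
  apply div_nonneg <;> linarith

lemma TT_le (e : ℕ → ℝ) (h : ∀ i, 4 ≤ e i) : TT e ≤ 1 / e 0 := by
  rw [TT_rec e h]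
  have := TT_nonneg (fun i => e (i + 1)) (fun i => h _)
  have := h 0
  gcongr
  linarith

lemma TT_ge (e : ℕ → ℝ) (h : ∀ i, 4 ≤ e i) : (1 - 1 / e 1) / e 0 ≤ TT e := by
  rw [TT_rec e h]
  have := TT_le (fun i => e (i + 1)) (fun i => h _)
  have := h 0
  gcongr

lemma TT_gap (e e' : ℕ → ℝ) (h : ∀ i, 4 ≤ e i) (h' : ∀ i, 4 ≤ e' i) (b : ℝ)
    (h1 : e 0 + 1 ≤ e' 0) (h2 : e 0 + 1 ≤ 2 * b) (h3 : 4 * b ≤ e 1) :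
    1 / (8 * b ^ 2) ≤ TT e - TT e' := by
  have a1 := TT_ge e h
  have a2 := TT_le e' h'
  have a0 := h 0
  have a3 : 1 / e' 0 ≤ 1 / (e 0 + 1) := one_div_le_one_div_of_le (by linarith) h1
  have a4 : 1 / e 1 ≤ 1 / (2 * (e 0 + 1)) := one_div_le_one_div_of_le (by linarith) (by linarith)
  have a5 : (1 - 1 / (2 * (e 0 + 1))) / e 0 ≤ (1 - 1 / e 1) / e 0 := by gcongr
  have a6 : (1 - 1 / (2 * (e 0 + 1))) / e 0 - 1 / (e 0 + 1) = 1 / (2 * e 0 * (e 0 + 1)) := by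
    have : e 0 ≠ 0 := by linarith
    have : e 0 + 1 ≠ 0 := by linarith
    field_simp
    ring
  have a7 : 1 / (8 * b ^ 2) ≤ 1 / (2 * e 0 * (e 0 + 1)) :=
    one_div_le_one_div_of_le (by positivity) (by nlinarith)
  linarith

lemma TT_agree (n : ℕ) : ∀ (e e' : ℕ → ℝ) (_ : ∀ i, 4 ≤ e i) (_ : ∀ i, 4 ≤ e' i)
    (_ : ∀ i < n, e i = e' i),
    |TT e - TT e'| = |TT (fun i => e (i + n)) - TT (fun i => e' (i + n))| /
      ∏ i ∈ Finset.range n, e i := by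
  induction n with
  | zero => intro e e' _ _ _; simp
  | succ n ih =>
    intro e e' h h' hh
    have := ih (fun i => e (i + 1)) (fun i => e' (i + 1)) (fun i => h _) (fun i => h' _)
      (fun i hi => hh _ (by omega))
    rw [TT_rec e h, TT_rec e' h', ← hh 0 (by omega), ← sub_div, abs_div,
      abs_of_pos (by linarith [h 0] : 0 < e 0), Finset.prod_range_succ', ← div_div]
    congr 1
    rw [show ∀ a b : ℝ, 1 - a - (1 - b) = -(a - b) by intros; ring, abs_neg, this]
    simp only [add_assoc]

/-- `N M n = ∏_{i<n} M^(i+1)` -/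
def NN (M n : ℕ) : ℕ := ∏ i ∈ Finset.range n, M ^ (i + 1)

def dig (M : ℕ) (x : ℝ) (n : ℕ) : ℕ := ⌊x * NN M (n + 1)⌋₊ % M ^ (n + 1)

def cc (M : ℕ) (x : ℝ) (n : ℕ) : ℕ := 1 + M ^ (n + 1) + dig M x n

lemma NN_pos {M : ℕ} (hM : 4 ≤ M) (n : ℕ) : 0 < NN M n :=
  Finset.prod_pos fun i _ => by positivity

lemma dig_lt {M : ℕ} (hM : 4 ≤ M) (x : ℝ) (n : ℕ) : dig M x n < M ^ (n + 1) :=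
  Nat.mod_lt _ (by positivity)

lemma floor_step {M : ℕ} (hM : 4 ≤ M) (x : ℝ) (n : ℕ) :
    ⌊x * NN M (n + 1)⌋₊ = M ^ (n + 1) * ⌊x * NN M n⌋₊ + dig M x n := by
  have : ⌊x * NN M n⌋₊ = ⌊x * NN M (n + 1)⌋₊ / M ^ (n + 1) := by
    rw [← Nat.floor_div_natCast]
    congr 1
    have : ((M ^ (n + 1) : ℕ) : ℝ) ≠ 0 := by positivity
    rw [NN, NN, Finset.prod_range_succ, Nat.cast_mul]
    field_simp
  rw [this, dig, Nat.div_add_mod]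

lemma floor_eq {M : ℕ} (hM : 4 ≤ M) {x y : ℝ} (hx : x ∈ Set.Ico (0 : ℝ) 1)
    (hy : y ∈ Set.Ico (0 : ℝ) 1) (n : ℕ) (h : ∀ i < n, dig M x i = dig M y i) :
    ⌊x * NN M n⌋₊ = ⌊y * NN M n⌋₊ := by
  induction n with
  | zero =>
    simp only [NN, Finset.range_zero, Finset.prod_empty, Nat.cast_one, mul_one]
    rw [Nat.floor_eq_zero.2 hx.2, Nat.floor_eq_zero.2 hy.2]
  | succ n ih =>
    rw [floor_step hM, floor_step hM, ih (fun i hi => h i (by omega)), h n (by omega)]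

lemma close {M : ℕ} (hM : 4 ≤ M) {x y : ℝ} (hx : x ∈ Set.Ico (0 : ℝ) 1)
    (hy : y ∈ Set.Ico (0 : ℝ) 1) (n : ℕ) (h : ∀ i < n, dig M x i = dig M y i) :
    |x - y| ≤ 1 / NN M n := by
  have h0 : (0 : ℝ) < NN M n := by exact_mod_cast NN_pos hM n
  have hf := floor_eq hM hx hy n h
  have a1 := Nat.floor_le (mul_nonneg hx.1 h0.le)
  have a2 := Nat.lt_floor_add_one (x * NN M n)
  have b1 := Nat.floor_le (mul_nonneg hy.1 h0.le)
  have b2 := Nat.lt_floor_add_one (y * NN M n)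
  rw [hf] at a1 a2
  have hab : |x - y| * (NN M n : ℝ) = |x * NN M n - y * NN M n| := by
    rw [← sub_mul, abs_mul, abs_of_pos h0]
  rw [le_div_iff₀ h0, hab, abs_le]
  constructor <;> linarith

def ee (M : ℕ) (x : ℝ) (n : ℕ) : ℝ := (M : ℝ) ^ (n + 1) + dig M x n

lemma pierce_cc (M : ℕ) (x : ℝ) : pierce (cc M x) = TT (ee M x) := by
  rw [pierce_eq]
  congr 1
  funext i
  simp only [cc, ee]
  push_cast
  ring

lemma ee_ge {M : ℕ} (x : ℝ) (n : ℕ) : (M : ℝ) ^ (n + 1) ≤ ee M x n := by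
  simp [ee]

lemma ee_four {M : ℕ} (hM : 4 ≤ M) (x : ℝ) (n : ℕ) : 4 ≤ ee M x n := by
  have h1 := ee_ge (M := M) x n
  have h2 : M ^ 1 ≤ M ^ (n + 1) := Nat.pow_le_pow_right (by omega) (by omega)
  rw [pow_one] at h2
  have h3 : (4 : ℝ) ≤ (M : ℝ) ^ (n + 1) := by
    exact_mod_cast (by omega : 4 ≤ M ^ (n + 1))
  linarith

lemma ee_le {M : ℕ} (hM : 4 ≤ M) (x : ℝ) (n : ℕ) : ee M x n + 1 ≤ 2 * (M : ℝ) ^ (n + 1) := by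
  have h : ((dig M x n + 1 : ℕ) : ℝ) ≤ ((M ^ (n + 1) : ℕ) : ℝ) :=
    Nat.cast_le.2 (dig_lt hM x n)
  push_cast at h
  simp only [ee]
  linarith

lemma gap_aux {M : ℕ} (hM : 4 ≤ M) (x y : ℝ) (n : ℕ) (h : dig M x n < dig M y n) :
    1 / (8 * ((M : ℝ) ^ (n + 1)) ^ 2) ≤
      TT (fun i => ee M x (i + n)) - TT (fun i => ee M y (i + n)) := by
  apply TT_gap
  · intro i; exact ee_four hM _ _
  · intro i; exact ee_four hM _ _
  · have : ((dig M x n + 1 : ℕ) : ℝ) ≤ dig M y n := Nat.cast_le.2 h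
    push_cast at this
    simp only [ee, zero_add]
    linarith
  · simpa using ee_le hM x n
  · have h1 := ee_ge (M := M) x (1 + n)
    refine le_trans ?_ h1
    have : (4 : ℝ) ≤ M := by exact_mod_cast hM
    rw [show 1 + n + 1 = (n + 1) + 1 by omega, pow_succ _ (n + 1), mul_comm]
    gcongr

lemma gap {M : ℕ} (hM : 4 ≤ M) (x y : ℝ) (n : ℕ) (hn : dig M x n ≠ dig M y n)
    (h : ∀ i < n, dig M x i = dig M y i) :
    1 / (8 * ((M : ℝ) ^ (n + 1)) ^ 2 * (2 ^ n * NN M n)) ≤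
      |pierce (cc M x) - pierce (cc M y)| := by
  rw [pierce_cc, pierce_cc, TT_agree n _ _ (ee_four hM x) (ee_four hM y)
    (fun i hi => by simp only [ee, h i hi])]
  have h1 : 1 / (8 * ((M : ℝ) ^ (n + 1)) ^ 2) ≤
      |TT (fun i => ee M x (i + n)) - TT (fun i => ee M y (i + n))| := by
    rcases lt_or_gt_of_ne hn with h | h
    · exact (gap_aux hM x y n h).trans (le_abs_self _)
    · rw [abs_sub_comm]
      exact (gap_aux hM y x n h).trans (le_abs_self _)
  have h2 : ∏ i ∈ Finset.range n, ee M x i ≤ 2 ^ n * NN M n := by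
    have := Finset.prod_le_prod (s := Finset.range n) (f := ee M x)
      (g := fun i => 2 * (M : ℝ) ^ (i + 1))
      (fun i _ => by linarith [ee_four hM x i]) (fun i _ => by linarith [ee_le hM x i])
    refine this.trans (le_of_eq ?_)
    rw [Finset.prod_mul_distrib, NN]
    simp
  have h3 : 0 < ∏ i ∈ Finset.range n, ee M x i :=
    lt_of_lt_of_le (by positivity) (prod_ge _ (ee_four hM x) n)
  rw [← div_div]
  gcongr

lemma NN_eq (M n : ℕ) : (NN M n : ℝ) ^ 2 = (M : ℝ) ^ (n * (n + 1)) := by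
  induction n with
  | zero => simp [NN]
  | succ n ih =>
    rw [NN, Finset.prod_range_succ, ← NN]
    push_cast
    rw [mul_pow, ih, ← pow_mul, ← pow_add]
    congr 1
    ring

lemma NN_rpow {M : ℕ} (hM : 4 ≤ M) (n : ℕ) : (NN M n : ℝ) = (M : ℝ) ^ ((n : ℝ) * (n + 1) / 2) := by
  have h0 : (0 : ℝ) < M := by exact_mod_cast (by omega : 0 < M)
  have h1 : (0 : ℝ) ≤ NN M n := by positivity
  rw [← Real.sqrt_sq h1, NN_eq, Real.sqrt_eq_rpow, ← Real.rpow_natCast, ← Real.rpow_mul h0.le]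
  congr 1
  push_cast
  ring

lemma holder_const {M : ℕ} (hM : 4 ≤ M) (s : ℝ) (hs0 : 0 < s) (hs1 : s < 1) :
    ∃ C : NNReal, ∀ n : ℕ, 1 / (NN M n : ℝ) ≤
      C * (1 / (8 * ((M : ℝ) ^ (n + 1)) ^ 2 * (2 ^ n * NN M n))) ^ s := by
  have hM4 : (4 : ℝ) ≤ M := by exact_mod_cast hM
  have h0 : (0 : ℝ) < M := by linarith
  have h1 : (1 : ℝ) ≤ M := by linarith
  let K : ℝ := 4 + 9 / (2 * (1 - s))
  refine ⟨⟨(M : ℝ) ^ K, by positivity⟩, fun n => ?_⟩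
  change _ ≤ (M : ℝ) ^ K * _
  have key : 8 * ((M : ℝ) ^ (n + 1)) ^ 2 * (2 ^ n * NN M n) ≤
      (M : ℝ) ^ ((3 * n + 4 : ℝ) + (n : ℝ) * (n + 1) / 2) := by
    rw [Real.rpow_add h0, ← NN_rpow hM, ← mul_assoc]
    gcongr
    have : (3 * n + 4 : ℝ) = ((3 * n + 4 : ℕ) : ℝ) := by push_cast; ring
    rw [this, Real.rpow_natCast]
    calc 8 * ((M : ℝ) ^ (n + 1)) ^ 2 * 2 ^ n ≤ (M : ℝ) ^ 2 * ((M : ℝ) ^ (n + 1)) ^ 2 * (M : ℝ) ^ n := by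
          gcongr
          · nlinarith
          · linarith
      _ = _ := by ring
  have hN : (0 : ℝ) < NN M n := by exact_mod_cast NN_pos hM n
  have key2 : (1 / (M : ℝ) ^ ((3 * n + 4 : ℝ) + (n : ℝ) * (n + 1) / 2)) ^ s ≤
      (1 / (8 * ((M : ℝ) ^ (n + 1)) ^ 2 * (2 ^ n * NN M n))) ^ s := by
    gcongr
  refine le_trans ?_ (mul_le_mul_of_nonneg_left key2 (by positivity))
  rw [NN_rpow hM, one_div, one_div, ← Real.rpow_neg h0.le, ← Real.rpow_neg h0.le,
    ← Real.rpow_mul h0.le, ← Real.rpow_add h0]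
  apply Real.rpow_le_rpow_of_exponent_le h1
  have ht : 0 < 1 - s := by linarith
  have hn : (0 : ℝ) ≤ n := Nat.cast_nonneg n
  -- 3 n ≤ 9/(2t) + t n^2/2
  have hA : 3 * (n : ℝ) ≤ 9 / (2 * (1 - s)) + (1 - s) * n ^ 2 / 2 := by
    have : 9 / (2 * (1 - s)) + (1 - s) * (n : ℝ) ^ 2 / 2 - 3 * n
        = (3 - (1 - s) * n) ^ 2 / (2 * (1 - s)) := by
      field_simp
      ring
    have h2 : 0 ≤ (3 - (1 - s) * (n : ℝ)) ^ 2 / (2 * (1 - s)) := by positivity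
    linarith
  have hB : (3 * (n : ℝ) + 4) * s ≤ 3 * n + 4 := by nlinarith
  have hC : 0 ≤ (1 - s) * (n : ℝ) := by positivity
  simp only [K]
  nlinarith

lemma main_lower (k : ℝ) (s : NNReal) (hs0 : 0 < s) (hs1 : s < 1) :
    (s : ENNReal) ≤ dimH {x : ℝ | ∃ c : ℕ → ℕ, StrictMono c ∧
        (∀ n : ℕ, Real.exp (k * ((n : ℝ) + 1)) ≤ (c n : ℝ)) ∧ x = pierce c} := by
  set S := {x : ℝ | ∃ c : ℕ → ℕ, StrictMono c ∧
        (∀ n : ℕ, Real.exp (k * ((n : ℝ) + 1)) ≤ (c n : ℝ)) ∧ x = pierce c} with hS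
  obtain ⟨M, hM, hMk⟩ : ∃ M : ℕ, 4 ≤ M ∧ Real.exp k ≤ M := by
    obtain ⟨m, hm⟩ := exists_nat_ge (Real.exp k)
    exact ⟨max 4 m, le_max_left _ _, hm.trans (by exact_mod_cast le_max_right _ _)⟩
  let g : ℝ → ℝ := fun x => pierce (cc M x)
  let I : Set ℝ := Set.Ico 0 1
  have hgS : g '' I ⊆ S := by
    rintro _ ⟨x, -, rfl⟩
    refine ⟨cc M x, strictMono_nat_of_lt_succ fun n => ?_, fun n => ?_, rfl⟩
    · have h1 := dig_lt hM x n
      have h2 : M ^ (n + 1 + 1) = M ^ (n + 1) * M := pow_succ _ _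
      simp only [cc]
      nlinarith
    · rw [show k * ((n : ℝ) + 1) = ((n + 1 : ℕ) : ℝ) * k by push_cast; ring, Real.exp_nat_mul]
      calc Real.exp k ^ (n + 1) ≤ (M : ℝ) ^ (n + 1) := by gcongr
        _ ≤ _ := by
          simp only [cc]
          push_cast
          have : (0 : ℝ) ≤ dig M x n := by positivity
          linarith
  obtain ⟨C, hC⟩ := holder_const hM (s : ℝ) (by exact_mod_cast hs0) (by exact_mod_cast hs1)
  have hmain : ∀ x ∈ I, ∀ y ∈ I, |x - y| ≤ C * |g x - g y| ^ (s : ℝ) := by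
    intro x hx y hy
    by_cases hd : ∃ n, dig M x n ≠ dig M y n
    · classical
      have hn := Nat.find_spec hd
      have hlt : ∀ i < Nat.find hd, dig M x i = dig M y i := fun i hi => by
        simpa using Nat.find_min hd hi
      have a1 := close hM hx hy _ hlt
      have a2 := gap hM x y _ hn hlt
      refine a1.trans ((hC _).trans ?_)
      gcongr
    · push Not at hd
      have : x = y := by
        have hb : ∀ n : ℕ, |x - y| ≤ (1 / 4 : ℝ) ^ n := fun n => by
          refine (close hM hx hy n (fun i _ => hd i)).trans ?_
          rw [one_div_pow]
          apply one_div_le_one_div_of_le (by positivity)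
          have : 4 ^ n ≤ NN M n := by
            have := Finset.prod_le_prod' (s := Finset.range n) (f := fun _ => 4)
              (g := fun i => M ^ (i + 1))
              (fun i _ => hM.trans (Nat.le_self_pow (by omega) M))
            simpa [NN] using this
          exact_mod_cast this
        have hl := tendsto_pow_atTop_nhds_zero_of_lt_one (r := (1 / 4 : ℝ)) (by norm_num) (by norm_num)
        have := ge_of_tendsto' hl hb
        exact sub_eq_zero.1 (abs_nonpos_iff.1 this)
      rw [this, sub_self, abs_zero]
      positivity
  have hinj : Set.InjOn g I := by
    intro x hx y hy hxy
    have := hmain x hx y hy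
    rw [hxy, sub_self, abs_zero, Real.zero_rpow (by exact_mod_cast hs0.ne'), mul_zero] at this
    exact sub_eq_zero.1 (abs_nonpos_iff.1 this)
  let f : ℝ → ℝ := Function.invFunOn g I
  have hf : ∀ x ∈ I, f (g x) = x := fun x hx => hinj.leftInvOn_invFunOn hx
  have hhol : HolderOnWith C s f (g '' I) := by
    rintro _ ⟨x, hx, rfl⟩ _ ⟨y, hy, rfl⟩
    rw [hf x hx, hf y hy, edist_dist, edist_dist, Real.dist_eq, Real.dist_eq,
      ENNReal.ofReal_rpow_of_nonneg (abs_nonneg _) s.coe_nonneg, ← ENNReal.ofReal_coe_nnreal,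
      ← ENNReal.ofReal_mul C.coe_nonneg]
    exact ENNReal.ofReal_le_ofReal (hmain x hx y hy)
  have h1 := hhol.dimH_image_le hs0
  have h2 : f '' (g '' I) = I := by
    rw [Set.image_image]
    ext z
    constructor
    · rintro ⟨x, hx, rfl⟩
      change f (g x) ∈ I
      rw [hf x hx]; exact hx
    · intro hz
      exact ⟨z, hz, hf z hz⟩
  have h3 : dimH I = 1 := by
    have := Real.dimH_of_nonempty_interior (E := ℝ) (s := I) (by simp [I])
    simpa using this
  rw [h2, h3, ENNReal.le_div_iff_mul_le (by left; exact_mod_cast hs0.ne') (by left; simp), one_mul] at h1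
  exact h1.trans (dimH_mono hgS)

end PierceAux

end

/-- For every `k ≥ 1`, the set of numbers whose Pierce digits in Perron
notation satisfy `c_n ≥ e^{kn}` for all `n ≥ 1` has Hausdorff dimension `1`. -/
theorem dimH_pierce_exp_growth (k : ℝ) (hk : 1 ≤ k) :
    dimH {x : ℝ | ∃ c : ℕ → ℕ, StrictMono c ∧
        (∀ n : ℕ, Real.exp (k * ((n : ℝ) + 1)) ≤ (c n : ℝ)) ∧ x = pierce c} = 1 := by
  apply le_antisymm
  · refine (dimH_mono (Set.subset_univ _)).trans ?_
    rw [Real.dimH_univ]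
  · refine le_of_forall_lt fun a ha => ?_
    obtain ⟨s, hs, hs1⟩ := ENNReal.lt_iff_exists_nnreal_btwn.1 ha
    have hs1' : s < 1 := by exact_mod_cast hs1
    have hs0 : 0 < s := by
      have : (0 : ENNReal) < s := lt_of_le_of_lt (zero_le) hs
      exact_mod_cast this
    exact lt_of_lt_of_le hs (PierceAux.main_lower k s hs0 hs1')
end
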